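/- Let n ≥ 4 be an integer. Then the function D ↦ D²·(λ̄₂(n,D) − λ̄₁(n,D)) is strictly increasing on (0, π): if 0 < D₁ < D₂ < π then D₁²·(λ̄₂(n,D₁) − λ̄₁(n,D₁)) < D₂²·(λ̄₂(n,D₂) − λ̄₁(n,D₂)). -/

import Mathlib

open Real Set

noncomputable section

/-- Rayleigh quotient of the one-dimensional model operator
`d²/ds² − (n−1)·tan(s)·d/ds` on `[−D/2, D/2]` with weight `cos^{n−1}(s)`. -/
def rayleighQ (n : ℕ) (D : ℝ) (φ : ℝ → ℝ) : ℝ :=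
  (∫ s in (-(D/2))..(D/2), deriv φ s ^ 2 * Real.cos s ^ (n-1)) /
  (∫ s in (-(D/2))..(D/2), φ s ^ 2 * Real.cos s ^ (n-1))

/-- The first model eigenvalue `λ̄₁(n,D)`: infimum of the Rayleigh quotient over
nonzero C¹ functions on `[−D/2, D/2]` vanishing at the endpoints. -/
def modelLam1 (n : ℕ) (D : ℝ) : ℝ :=
  sInf (rayleighQ n D '' {φ : ℝ → ℝ | ContDiffOn ℝ 1 φ (Set.Icc (-(D/2)) (D/2)) ∧
    (∃ s ∈ Set.Icc (-(D/2)) (D/2), φ s ≠ 0) ∧ φ (-(D/2)) = 0 ∧ φ (D/2) = 0})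

/-- The second model eigenvalue `λ̄₂(n,D)`: the same infimum restricted to odd functions. -/
def modelLam2 (n : ℕ) (D : ℝ) : ℝ :=
  sInf (rayleighQ n D '' {φ : ℝ → ℝ | ContDiffOn ℝ 1 φ (Set.Icc (-(D/2)) (D/2)) ∧
    (∃ s ∈ Set.Icc (-(D/2)) (D/2), φ s ≠ 0) ∧
    (∀ s ∈ Set.Icc (-(D/2)) (D/2), φ (-s) = -φ s) ∧ φ (-(D/2)) = 0 ∧ φ (D/2) = 0})

/-- A real sequence of subexponential growth. -/
def SubExp (b : ℕ → ℝ) : Prop :=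
  ∀ q : ℝ, 0 < q → q < 1 → ∃ C, ∀ j, |b j| * q ^ j ≤ C

lemma SubExp.summable_abs {b : ℕ → ℝ} (hb : SubExp b) {q : ℝ} (hq0 : 0 ≤ q) (hq1 : q < 1) :
    Summable fun j => |b j| * q ^ j := by
  obtain ⟨p, hqp, hp1⟩ := exists_between hq1
  have hp0 : 0 < p := hq0.trans_lt hqp
  obtain ⟨C, hC⟩ := hb p hp0 hp1
  have hg : Summable fun j : ℕ => C * (q / p) ^ j :=
    (summable_geometric_of_lt_one (by positivity) ((div_lt_one hp0).2 hqp)).mul_left C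
  refine hg.of_nonneg_of_le (fun j => by positivity) fun j => ?_
  calc |b j| * q ^ j = (|b j| * p ^ j) * (q / p) ^ j := by
        rw [div_pow]; field_simp
    _ ≤ C * (q / p) ^ j := mul_le_mul_of_nonneg_right (hC j) (by positivity)

lemma SubExp.deriv {b : ℕ → ℝ} (hb : SubExp b) : SubExp fun j => (j + 1) * b (j + 1) := by
  intro q hq0 hq1
  obtain ⟨p, hqp, hp1⟩ := exists_between hq1
  have hp0 : 0 < p := hq0.trans hqp
  obtain ⟨C, hC⟩ := hb p hp0 hp1
  obtain ⟨K, hK⟩ := (tendsto_self_mul_const_pow_of_lt_one (r := q / p) (by positivity)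
    ((div_lt_one hp0).2 hqp)).bddAbove_range
  refine ⟨K * (C / q), fun j => ?_⟩
  have hK' : ((j + 1 : ℕ) : ℝ) * (q / p) ^ (j + 1) ≤ K := hK ⟨j + 1, rfl⟩
  have hC0 : 0 ≤ C := (by positivity : 0 ≤ |b 0| * p ^ 0).trans (hC 0)
  calc |((j : ℝ) + 1) * b (j + 1)| * q ^ j
      = (((j + 1 : ℕ) : ℝ) * (q / p) ^ (j + 1)) * ((|b (j + 1)| * p ^ (j + 1)) / q) := by
        rw [abs_mul, abs_of_nonneg (by positivity : (0 : ℝ) ≤ j + 1), div_pow]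
        push_cast
        field_simp
        ring
    _ ≤ K * (C / q) := by
        refine mul_le_mul hK' ?_ (by positivity) (le_trans (by positivity) hK')
        exact div_le_div_of_nonneg_right (hC _) hq0.le

lemma SubExp.summable {b : ℕ → ℝ} (hb : SubExp b) {x : ℝ} (hx : |x| < 1) :
    Summable fun j => b j * x ^ j := by
  refine Summable.of_norm ?_
  simpa [abs_mul, abs_pow] using hb.summable_abs (abs_nonneg x) hx

lemma SubExp.hasDerivAt {b : ℕ → ℝ} (hb : SubExp b) {x : ℝ} (hx : |x| < 1) :
    HasDerivAt (fun y => ∑' j, b j * y ^ j) (∑' j : ℕ, ((j + 1) * b (j + 1)) * x ^ j) x := by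
  obtain ⟨r, hxr, hr1⟩ := exists_between hx
  have hr0 : 0 < r := (abs_nonneg x).trans_lt hxr
  have hsum : Summable fun j : ℕ => |b j| * (j * r ^ (j - 1)) := by
    rw [← summable_nat_add_iff 1]
    refine (hb.deriv.summable_abs hr0.le hr1).congr fun j => ?_
    rw [abs_mul, abs_of_nonneg (by positivity : (0 : ℝ) ≤ j + 1)]
    push_cast [Nat.add_sub_cancel]
    ring
  have hmem : x ∈ Metric.ball (0 : ℝ) r := by simpa using hxr
  have key := hasDerivAt_tsum_of_isPreconnected (t := Metric.ball (0 : ℝ) r)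
    (g := fun j y => b j * y ^ j) (g' := fun j y => b j * (j * y ^ (j - 1))) (y₀ := x) hsum
    Metric.isOpen_ball (convex_ball _ _).isPreconnected
    (fun j y _ => (hasDerivAt_pow j y).const_mul (b j))
    (fun j y hy => by
      have hy' : |y| ≤ r := by simpa using (Metric.mem_ball.1 hy).le
      rw [Real.norm_eq_abs, abs_mul, abs_mul, abs_pow, Nat.abs_cast]
      gcongr) hmem (hb.summable hx) hmem
  refine key.congr_deriv ?_
  have hs : Summable fun j : ℕ => b j * (j * x ^ (j - 1)) := by
    rw [← summable_nat_add_iff 1]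
    refine (hb.deriv.summable hx).congr fun j => ?_
    push_cast [Nat.add_sub_cancel]
    ring
  rw [hs.tsum_eq_zero_add]
  simp only [Nat.cast_zero, zero_mul, mul_zero, zero_add]
  refine tsum_congr fun j => ?_
  push_cast [Nat.add_sub_cancel]
  ring

/-- Taylor coefficients at `0` of the solution of the ultraspherical equation
`(1 - x²) Y'' - (m + 1) x Y' + lam Y = 0` with `Y 0 = c₀` and `Y' 0 = c₁`. -/
def ultraCoeff (m : ℕ) (lam c₀ c₁ : ℝ) : ℕ → ℝ
  | 0 => c₀
  | 1 => c₁
  | j + 2 => ((j : ℝ) * (j + m) - lam) / ((j + 1) * (j + 2)) * ultraCoeff m lam c₀ c₁ j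

lemma abs_ultraCoeff_le {m : ℕ} {lam L c₀ c₁ : ℝ} (hL : |lam| ≤ L) (h₀ : |c₀| ≤ 1)
    (h₁ : |c₁| ≤ 1) : ∀ j, |ultraCoeff m lam c₀ c₁ j| ≤ ultraCoeff m (-L) 1 1 j
  | 0 => h₀
  | 1 => h₁
  | j + 2 => by
    rw [ultraCoeff, ultraCoeff, abs_mul, abs_div,
      abs_of_pos (by positivity : (0 : ℝ) < (j + 1) * (j + 2))]
    have ih := abs_ultraCoeff_le (m := m) hL h₀ h₁ j
    have hn : |(j : ℝ) * (j + m) - lam| ≤ j * (j + m) - -L := by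
      refine (abs_sub _ _).trans ?_
      rw [abs_of_nonneg (by positivity : (0 : ℝ) ≤ j * (j + m))]
      linarith
    exact mul_le_mul (by gcongr) ih (abs_nonneg _)
      (div_nonneg ((abs_nonneg _).trans hn) (by positivity))

lemma ultraCoeff_nonneg {m : ℕ} {L c₀ c₁ : ℝ} (hL : 0 ≤ L) (h₀ : 0 ≤ c₀) (h₁ : 0 ≤ c₁) :
    ∀ j, 0 ≤ ultraCoeff m (-L) c₀ c₁ j
  | 0 => h₀
  | 1 => h₁
  | j + 2 => by
    rw [ultraCoeff]
    have := ultraCoeff_nonneg (m := m) hL h₀ h₁ j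
    refine mul_nonneg (div_nonneg ?_ (by positivity)) this
    have : (0 : ℝ) ≤ j * (j + m) := by positivity
    linarith

lemma tendsto_ultraRatio (m : ℕ) (L : ℝ) :
    Filter.Tendsto (fun j : ℕ => ((j : ℝ) * (j + m) - L) / ((j + 1) * (j + 2)))
      Filter.atTop (nhds 1) := by
  have h1 : Filter.Tendsto (fun j : ℕ => (1 : ℝ) / (j + 1)) Filter.atTop (nhds 0) :=
    tendsto_one_div_add_atTop_nhds_zero_nat
  have h2 : Filter.Tendsto (fun j : ℕ => (1 : ℝ) / ((j + 1 : ℕ) + 1)) Filter.atTop (nhds 0) :=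
    h1.comp (Filter.tendsto_add_atTop_nat 1)
  have h : Filter.Tendsto (fun j : ℕ => (1 - (1 : ℝ) / (j + 1)) *
      (1 + (m - 2) * (1 / ((j + 1 : ℕ) + 1))) - L * (1 / (j + 1)) * (1 / ((j + 1 : ℕ) + 1)))
      Filter.atTop (nhds ((1 - 0) * (1 + (m - 2) * 0) - L * 0 * 0)) :=
    ((h1.const_sub 1).mul ((h2.const_mul _).const_add 1)).sub ((h1.const_mul L).mul h2)
  simp only [sub_zero, mul_zero, add_zero, mul_one] at h
  refine h.congr fun j => ?_
  push_cast
  have : (j : ℝ) + 1 + 1 = j + 2 := by ring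
  rw [this]
  field_simp
  ring

lemma subExp_ultraCoeff (m : ℕ) (lam c₀ c₁ : ℝ) : SubExp (ultraCoeff m lam c₀ c₁) := by
  intro q hq0 hq1
  have hlim := ((tendsto_ultraRatio m lam).abs.mul_const (q ^ 2))
  have hlt : |(1 : ℝ)| * q ^ 2 < 1 := by
    rw [abs_one, one_mul]
    exact pow_lt_one₀ hq0.le hq1 two_ne_zero
  obtain ⟨N, hN⟩ := Filter.eventually_atTop.1 (hlim.eventually_lt_const hlt)
  set f : ℕ → ℝ := fun j => |ultraCoeff m lam c₀ c₁ j| * q ^ j with hf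
  have hf0 : ∀ j, 0 ≤ f j := fun j => by positivity
  refine ⟨∑ i ∈ Finset.range (N + 2), f i, fun j => ?_⟩
  induction j using Nat.strong_induction_on with
  | _ j ih =>
    by_cases hj : j < N + 2
    · exact Finset.single_le_sum (f := f) (fun i _ => hf0 i) (Finset.mem_range.2 hj)
    · obtain ⟨i, rfl⟩ : ∃ i, j = i + 2 := ⟨j - 2, by omega⟩
      refine le_trans ?_ (ih i (by omega))
      have h := hN i (by omega)
      calc |ultraCoeff m lam c₀ c₁ (i + 2)| * q ^ (i + 2)
          = (|((i : ℝ) * (i + m) - lam) / ((i + 1) * (i + 2))| * q ^ 2) *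
            (|ultraCoeff m lam c₀ c₁ i| * q ^ i) := by
            rw [ultraCoeff, abs_mul]; ring
        _ ≤ 1 * (|ultraCoeff m lam c₀ c₁ i| * q ^ i) :=
            mul_le_mul_of_nonneg_right h.le (by positivity)
        _ = _ := one_mul _

/-- The solution of the ultraspherical equation as a power series. -/
def ultra (m : ℕ) (lam c₀ c₁ x : ℝ) : ℝ := ∑' j, ultraCoeff m lam c₀ c₁ j * x ^ j

/-- The derivative of `ultra` in its last variable. -/
def ultraDeriv (m : ℕ) (lam c₀ c₁ x : ℝ) : ℝ :=
  ∑' j : ℕ, ((j + 1) * ultraCoeff m lam c₀ c₁ (j + 1)) * x ^ j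

lemma hasDerivAt_ultra (m : ℕ) (lam c₀ c₁ : ℝ) {x : ℝ} (hx : |x| < 1) :
    HasDerivAt (ultra m lam c₀ c₁) (ultraDeriv m lam c₀ c₁ x) x :=
  (subExp_ultraCoeff m lam c₀ c₁).hasDerivAt hx

lemma hasDerivAt_ultraDeriv (m : ℕ) (lam c₀ c₁ : ℝ) {x : ℝ} (hx : |x| < 1) :
    HasDerivAt (ultraDeriv m lam c₀ c₁)
      (((m + 1) * x * ultraDeriv m lam c₀ c₁ x - lam * ultra m lam c₀ c₁ x) / (1 - x ^ 2)) x := by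
  have hb := subExp_ultraCoeff m lam c₀ c₁
  refine (hb.deriv.hasDerivAt hx).congr_deriv (Eq.symm ?_)
  set b := ultraCoeff m lam c₀ c₁ with hbdef
  have hx2 : 1 - x ^ 2 ≠ 0 := by
    have := (sq_lt_one_iff_abs_lt_one x).2 hx
    linarith
  have e0 : HasSum (fun j => b j * x ^ j) (ultra m lam c₀ c₁ x) := (hb.summable hx).hasSum
  have e1 : HasSum (fun j : ℕ => (j + 1) * b (j + 1) * x ^ j) (ultraDeriv m lam c₀ c₁ x) :=
    (hb.deriv.summable hx).hasSum
  have e2 := (hb.deriv.deriv.summable hx).hasSum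
  have e1' : HasSum (fun j : ℕ => j * b j * x ^ j) (x * ultraDeriv m lam c₀ c₁ x) := by
    rw [← hasSum_nat_add_iff' 1]
    simp only [Finset.range_one, Finset.sum_singleton, Nat.cast_zero, zero_mul, sub_zero]
    convert! e1.mul_left x using 2 with j
    push_cast
    ring
  have e2' : HasSum (fun j : ℕ => j * (j - 1) * b j * x ^ j)
      (x ^ 2 * ∑' j : ℕ, ((j : ℝ) + 1) * (((j + 1 : ℕ) + 1) * b (j + 1 + 1)) * x ^ j) := by
    rw [← hasSum_nat_add_iff' 2]
    simp only [Finset.sum_range_succ, Finset.range_zero, Finset.sum_empty, Nat.cast_zero,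
      Nat.cast_one, sub_self, mul_zero, zero_mul, add_zero, sub_zero]
    convert! e2.mul_left (x ^ 2) using 2 with j
    push_cast
    ring
  rw [div_eq_iff hx2]
  have := ((e2.sub e2').sub (e1'.mul_left ((m : ℝ) + 1))).add (e0.mul_left lam)
  have hzero : ∀ j : ℕ, ((j : ℝ) + 1) * (((j + 1 : ℕ) + 1) * b (j + 1 + 1)) * x ^ j -
      j * (j - 1) * b j * x ^ j - (m + 1) * (j * b j * x ^ j) + lam * (b j * x ^ j) = 0 := by
    intro j
    simp only [hbdef, ultraCoeff]
    push_cast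
    field_simp
    ring
  simp only [hzero] at this
  linear_combination -this.unique hasSum_zero

lemma ultraCoeff_neg_right (m : ℕ) (lam c₀ c₁ : ℝ) :
    ∀ j, ultraCoeff m lam c₀ (-c₁) j = (-1) ^ j * ultraCoeff m lam c₀ c₁ j
  | 0 => by simp [ultraCoeff]
  | 1 => by simp [ultraCoeff]
  | j + 2 => by
    rw [ultraCoeff, ultraCoeff, ultraCoeff_neg_right m lam c₀ c₁ j]
    ring

lemma ultraCoeff_neg (m : ℕ) (lam c₀ c₁ : ℝ) :
    ∀ j, ultraCoeff m lam (-c₀) (-c₁) j = -ultraCoeff m lam c₀ c₁ j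
  | 0 => by simp [ultraCoeff]
  | 1 => by simp [ultraCoeff]
  | j + 2 => by
    rw [ultraCoeff, ultraCoeff, ultraCoeff_neg m lam c₀ c₁ j]
    ring

lemma ultra_neg (m : ℕ) (lam c₀ c₁ x : ℝ) :
    ultra m lam c₀ c₁ (-x) = ultra m lam c₀ (-c₁) x := by
  unfold ultra
  refine tsum_congr fun j => ?_
  rw [ultraCoeff_neg_right, neg_pow]
  ring

lemma ultra_even (m : ℕ) (lam x : ℝ) : ultra m lam 1 0 (-x) = ultra m lam 1 0 x := by
  rw [ultra_neg, neg_zero]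

lemma ultra_odd (m : ℕ) (lam x : ℝ) : ultra m lam 0 1 (-x) = -ultra m lam 0 1 x := by
  rw [ultra_neg]
  unfold ultra
  rw [← tsum_neg]
  refine tsum_congr fun j => ?_
  have := ultraCoeff_neg m lam 0 1 j
  rw [neg_zero] at this
  rw [this, neg_mul]

/-- The series of `ultra` with its first `e` coefficients dropped, divided by `x ^ e`. -/
def ultraTail (m e : ℕ) (c₀ c₁ lam x : ℝ) : ℝ := ∑' j, ultraCoeff m lam c₀ c₁ (j + e) * x ^ j

lemma continuous_ultraCoeff (m : ℕ) (c₀ c₁ : ℝ) :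
    ∀ j, Continuous fun lam => ultraCoeff m lam c₀ c₁ j
  | 0 => by simpa [ultraCoeff] using continuous_const
  | 1 => by simpa [ultraCoeff] using continuous_const
  | j + 2 => by
    have := continuous_ultraCoeff m c₀ c₁ j
    simp only [ultraCoeff]
    fun_prop

lemma continuousAt_ultraTail (m e : ℕ) {c₀ c₁ : ℝ} (h₀ : |c₀| ≤ 1) (h₁ : |c₁| ≤ 1) (lam : ℝ)
    {x : ℝ} (hx : |x| < 1) :
    ContinuousAt (Function.uncurry (ultraTail m e c₀ c₁)) (lam, x) := by
  obtain ⟨r, hxr, hr1⟩ := exists_between hx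
  have hr0 : 0 < r := (abs_nonneg x).trans_lt hxr
  have hopen : IsOpen {p : ℝ × ℝ | |p.1| < |lam| + 1 ∧ |p.2| < r} :=
    (isOpen_lt continuous_fst.abs continuous_const).and
      (isOpen_lt continuous_snd.abs continuous_const)
  have hB := (subExp_ultraCoeff m (-(|lam| + 1)) 1 1).summable
    (x := r) (by rwa [abs_of_pos hr0])
  have hB' := (((summable_nat_add_iff e).2 hB).mul_right (r ^ e)⁻¹)
  have hcont : ContinuousOn (Function.uncurry (ultraTail m e c₀ c₁))
      {p : ℝ × ℝ | |p.1| < |lam| + 1 ∧ |p.2| < r} := by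
    refine continuousOn_tsum
      (f := fun j (p : ℝ × ℝ) => ultraCoeff m p.1 c₀ c₁ (j + e) * p.2 ^ j) (fun j => ?_) hB'
      fun j p hp => ?_
    · have := continuous_ultraCoeff m c₀ c₁ (j + e)
      exact Continuous.continuousOn (by fun_prop)
    · have hle := abs_ultraCoeff_le (m := m) hp.1.le h₀ h₁ (j + e)
      rw [Real.norm_eq_abs, abs_mul, abs_pow]
      calc _ ≤ ultraCoeff m (-(|lam| + 1)) 1 1 (j + e) * r ^ j :=
            mul_le_mul hle (by gcongr; exact hp.2.le) (by positivity) ((abs_nonneg _).trans hle)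
        _ = _ := by rw [pow_add]; field_simp
  exact hcont.continuousAt (hopen.mem_nhds ⟨by simp, hxr⟩)

lemma ultraTail_zero_right (m e : ℕ) (c₀ c₁ lam : ℝ) :
    ultraTail m e c₀ c₁ lam 0 = ultraCoeff m lam c₀ c₁ e := by
  unfold ultraTail
  rw [tsum_eq_single 0 (fun j hj => by simp [hj])]
  simp

lemma ultra_eq_ultraTail_zero (m : ℕ) (c₀ c₁ lam x : ℝ) :
    ultra m lam c₀ c₁ x = x ^ 0 * ultraTail m 0 c₀ c₁ lam x := by
  simp [ultra, ultraTail]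

lemma ultra_eq_ultraTail_one (m : ℕ) (c₁ lam : ℝ) {x : ℝ} (hx : |x| < 1) :
    ultra m lam 0 c₁ x = x ^ 1 * ultraTail m 1 0 c₁ lam x := by
  unfold ultra ultraTail
  rw [((subExp_ultraCoeff m lam 0 c₁).summable hx).tsum_eq_zero_add, ← tsum_mul_left]
  simp only [ultraCoeff, zero_mul, zero_add]
  refine tsum_congr fun j => ?_
  ring

lemma one_le_ultraTail (m e : ℕ) {c₀ c₁ : ℝ} (h₀ : 0 ≤ c₀) (h₁ : 0 ≤ c₁)
    (he : ultraCoeff m 0 c₀ c₁ e = 1) {x : ℝ} (hx0 : 0 ≤ x) (hx1 : x < 1) :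
    1 ≤ ultraTail m e c₀ c₁ 0 x := by
  have hnn : ∀ j, 0 ≤ ultraCoeff m 0 c₀ c₁ j := by
    simpa using ultraCoeff_nonneg (m := m) le_rfl h₀ h₁
  have hs : Summable fun j => ultraCoeff m 0 c₀ c₁ (j + e) * x ^ j := by
    obtain rfl | hx := hx0.eq_or_lt
    · exact summable_of_ne_finset_zero (s := {0}) fun j hj => by
        simp at hj
        simp [hj]
    · refine (((summable_nat_add_iff e).2 ((subExp_ultraCoeff m 0 c₀ c₁).summable
        (x := x) (by rwa [abs_of_pos hx]))).mul_right (x ^ e)⁻¹).congr fun j => ?_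
      rw [pow_add]
      field_simp
  have := hs.le_tsum 0 fun j _ => mul_nonneg (hnn _) (pow_nonneg hx0 _)
  simpa [he, ultraTail] using this

/-- A continuous family that is positive on `[0, r]` for some but not arbitrarily large
parameters touches zero there at the supremum of the parameters of positivity. -/
lemma exists_isLUB_touch {P : ℝ → ℝ → ℝ} {r : ℝ}
    (hc : ∀ lam, ∀ x ∈ Icc 0 r, ContinuousAt (Function.uncurry P) (lam, x))
    (hne : {lam | ∀ x ∈ Icc 0 r, 0 < P lam x}.Nonempty)
    (hbdd : BddAbove {lam | ∀ x ∈ Icc 0 r, 0 < P lam x}) :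
    ∃ Λ, IsLUB {lam | ∀ x ∈ Icc 0 r, 0 < P lam x} Λ ∧ (∀ x ∈ Icc 0 r, 0 ≤ P Λ x) ∧
      ∃ x ∈ Icc 0 r, P Λ x = 0 := by
  have hlub := isLUB_csSup hne hbdd
  set S := {lam | ∀ x ∈ Icc 0 r, 0 < P lam x} with hS
  set Λ := sSup S
  have hnonneg : ∀ x ∈ Icc 0 r, 0 ≤ P Λ x := by
    intro x hx
    by_contra! hneg
    have hcx : ContinuousAt (fun lam => P lam x) Λ :=
      ContinuousAt.comp (g := Function.uncurry P) (f := fun lam => (lam, x)) (hc Λ x hx)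
        (by fun_prop)
    have hev := hcx.eventually_lt_const hneg
    obtain ⟨lam, hlam, hlt⟩ := ((mem_closure_iff_frequently.1
      (hlub.mem_closure hne)).and_eventually hev).exists
    exact lt_asymm hlt (hlam x hx)
  refine ⟨Λ, hlub, hnonneg, ?_⟩
  by_contra! hno
  have hpos : ∀ x ∈ Icc 0 r, 0 < P Λ x := fun x hx => (hnonneg x hx).lt_of_ne' (hno x hx)
  have hev := isCompact_Icc.eventually_forall_of_forall_eventually (x₀ := Λ)
    (P := fun lam x => 0 < P lam x) fun x hx =>
      (hc Λ x hx).eventually_const_lt (hpos x hx)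
  obtain ⟨lam, hlam, hlt⟩ := ((hev.filter_mono nhdsWithin_le_nhds).and
    (self_mem_nhdsWithin (s := Ioi Λ))).exists
  exact (not_lt.2 (hlub.1 hlam)) hlt

/-- The solution of `y'' - m tan(s) y' + lam y = 0` on `(-π/2, π/2)` with `y 0 = c₀`,
`y' 0 = c₁`. -/
def sol (m : ℕ) (lam c₀ c₁ s : ℝ) : ℝ := ultra m lam c₀ c₁ (sin s)

/-- The derivative of `sol` in its last variable. -/
def solDeriv (m : ℕ) (lam c₀ c₁ s : ℝ) : ℝ := ultraDeriv m lam c₀ c₁ (sin s) * cos s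

lemma cos_pos_of_abs_lt {s : ℝ} (hs : |s| < π / 2) : 0 < cos s :=
  cos_pos_of_mem_Ioo (abs_lt.1 hs)

lemma abs_sin_lt_one {s : ℝ} (hs : |s| < π / 2) : |sin s| < 1 := by
  rw [← sq_lt_one_iff_abs_lt_one, sin_sq]
  have := cos_pos_of_abs_lt hs
  nlinarith

lemma hasDerivAt_sol (m : ℕ) (lam c₀ c₁ : ℝ) {s : ℝ} (hs : |s| < π / 2) :
    HasDerivAt (sol m lam c₀ c₁) (solDeriv m lam c₀ c₁ s) s :=
  (hasDerivAt_ultra m lam c₀ c₁ (abs_sin_lt_one hs)).comp s (hasDerivAt_sin s)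

lemma hasDerivAt_solDeriv (m : ℕ) (lam c₀ c₁ : ℝ) {s : ℝ} (hs : |s| < π / 2) :
    HasDerivAt (solDeriv m lam c₀ c₁)
      (m * tan s * solDeriv m lam c₀ c₁ s - lam * sol m lam c₀ c₁ s) s := by
  have h := ((hasDerivAt_ultraDeriv m lam c₀ c₁ (abs_sin_lt_one hs)).comp s
    (hasDerivAt_sin s)).mul (hasDerivAt_cos s)
  refine h.congr_deriv ?_
  have hc := (cos_pos_of_abs_lt hs).ne'
  simp only [Function.comp, solDeriv, sol, tan_eq_sin_div_cos]
  rw [show 1 - sin s ^ 2 = cos s ^ 2 by rw [cos_sq']]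
  field_simp
  ring

lemma hasDerivAt_cos_pow_mul_solDeriv (m : ℕ) (lam c₀ c₁ : ℝ) {s : ℝ} (hs : |s| < π / 2) :
    HasDerivAt (fun s => cos s ^ m * solDeriv m lam c₀ c₁ s)
      (-(lam * cos s ^ m * sol m lam c₀ c₁ s)) s := by
  refine (((hasDerivAt_cos s).pow m).mul (hasDerivAt_solDeriv m lam c₀ c₁ hs)).congr_deriv ?_
  have hc := (cos_pos_of_abs_lt hs).ne'
  rw [tan_eq_sin_div_cos]
  rcases m with _ | m
  · simp
  · rw [Nat.add_sub_cancel, pow_succ]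
    push_cast
    simp only [Pi.mul_apply, Pi.pow_apply]
    field_simp
    ring

lemma sol_zero_right (m : ℕ) (lam c₀ c₁ : ℝ) : sol m lam c₀ c₁ 0 = c₀ := by
  rw [sol, sin_zero, ultra_eq_ultraTail_zero, ultraTail_zero_right]
  simp [ultraCoeff]

lemma solDeriv_zero_right (m : ℕ) (lam c₀ c₁ : ℝ) : solDeriv m lam c₀ c₁ 0 = c₁ := by
  rw [solDeriv, sin_zero, cos_zero, ultraDeriv, tsum_eq_single 0 (fun j hj => by simp [hj])]
  simp [ultraCoeff]

lemma sol_even (m : ℕ) (lam s : ℝ) : sol m lam 1 0 (-s) = sol m lam 1 0 s := by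
  rw [sol, sin_neg, ultra_even, sol]

lemma sol_odd (m : ℕ) (lam s : ℝ) : sol m lam 0 1 (-s) = -sol m lam 0 1 s := by
  rw [sol, sin_neg, ultra_odd, sol]

lemma continuousOn_sol (m : ℕ) (lam c₀ c₁ : ℝ) :
    ContinuousOn (sol m lam c₀ c₁) {s | |s| < π / 2} :=
  fun _ hs => (hasDerivAt_sol m lam c₀ c₁ hs).continuousAt.continuousWithinAt

lemma continuousOn_solDeriv (m : ℕ) (lam c₀ c₁ : ℝ) :
    ContinuousOn (solDeriv m lam c₀ c₁) {s | |s| < π / 2} :=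
  fun _ hs => (hasDerivAt_solDeriv m lam c₀ c₁ hs).continuousAt.continuousWithinAt

/-- A nonnegative solution dominated in frequency by a positive one has no interior zero. -/
lemma sol_pos_of_nonneg {m : ℕ} {lam mu c₀ c₁ a : ℝ} (ha : a < π / 2) (hlt : mu < lam)
    (hmu : ∀ s ∈ Ioc 0 a, 0 < sol m mu c₀ c₁ s) (hlam : ∀ s ∈ Icc 0 a, 0 ≤ sol m lam c₀ c₁ s)
    (hnear : ∀ᶠ s in nhdsWithin 0 (Ioi 0), 0 < sol m lam c₀ c₁ s) :
    ∀ s ∈ Ioo 0 a, 0 < sol m lam c₀ c₁ s := by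
  intro s₁ hs₁
  refine (hlam s₁ (Ioo_subset_Icc_self hs₁)).lt_of_ne' fun hzero => ?_
  have habs : ∀ s ∈ Icc 0 a, |s| < π / 2 := fun s hs => by
    rw [abs_of_nonneg hs.1]; exact hs.2.trans_lt ha
  have hmin : IsLocalMin (sol m lam c₀ c₁) s₁ := by
    filter_upwards [Icc_mem_nhds hs₁.1 hs₁.2] with s hs
    rw [hzero]; exact hlam s hs
  have hd : solDeriv m lam c₀ c₁ s₁ = 0 :=
    hmin.hasDerivAt_eq_zero (hasDerivAt_sol m lam c₀ c₁ (habs s₁ (Ioo_subset_Icc_self hs₁)))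
  set Q : ℝ → ℝ := fun s => (cos s ^ m * solDeriv m lam c₀ c₁ s) * sol m mu c₀ c₁ s -
    sol m lam c₀ c₁ s * (cos s ^ m * solDeriv m mu c₀ c₁ s) with hQ
  have hQd : ∀ s ∈ Icc 0 a, HasDerivAt Q
      ((mu - lam) * cos s ^ m * sol m lam c₀ c₁ s * sol m mu c₀ c₁ s) s := fun s hs => by
    refine (((hasDerivAt_cos_pow_mul_solDeriv m lam c₀ c₁ (habs s hs)).mul
      (hasDerivAt_sol m mu c₀ c₁ (habs s hs))).sub ((hasDerivAt_sol m lam c₀ c₁ (habs s hs)).mul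
      (hasDerivAt_cos_pow_mul_solDeriv m mu c₀ c₁ (habs s hs)))).congr_deriv ?_
    ring
  have hQ0 : Q 0 = 0 := by simp [hQ, sol_zero_right, solDeriv_zero_right, mul_comm]
  have hQ1 : Q s₁ = 0 := by simp [hQ, hzero, hd]
  have hanti : AntitoneOn Q (Icc 0 a) := by
    refine antitoneOn_of_hasDerivWithinAt_nonpos (convex_Icc 0 a)
      (fun s hs => (hQd s hs).continuousAt.continuousWithinAt)
      (fun s hs => (hQd s (interior_subset hs)).hasDerivWithinAt) fun s hs => ?_
    have hs' := interior_subset hs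
    rw [interior_Icc] at hs
    have h1 := hlam s hs'
    have h2 := hmu s (Ioo_subset_Ioc_self hs)
    have h3 := cos_pos_of_abs_lt (habs s hs')
    have : 0 ≤ (lam - mu) * cos s ^ m * sol m lam c₀ c₁ s * sol m mu c₀ c₁ s := by
      have := sub_pos.2 hlt
      positivity
    linarith
  obtain ⟨s, hspos, hs⟩ := (hnear.and (Ioo_mem_nhdsGT hs₁.1)).exists
  have hsa : s ∈ Icc 0 a := ⟨hs.1.le, hs.2.le.trans hs₁.2.le⟩
  have hconst : Q =ᶠ[nhds s] fun _ => 0 := by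
    filter_upwards [Icc_mem_nhds hs.1 hs.2] with t ht
    have hta : t ∈ Icc 0 a := ⟨ht.1, ht.2.trans hs₁.2.le⟩
    refine le_antisymm ?_ ?_
    · rw [← hQ0]; exact hanti ⟨le_rfl, hs₁.1.le.trans hs₁.2.le⟩ hta ht.1
    · rw [← hQ1]; exact hanti hta (Ioo_subset_Icc_self hs₁) ht.2
  have h0 := (hQd s hsa).unique ((hasDerivAt_const s (0 : ℝ)).congr_of_eventuallyEq hconst)
  have h2 := hmu s ⟨hs.1, hsa.2⟩
  have h3 := cos_pos_of_abs_lt (habs s hsa)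
  have := sub_ne_zero.2 hlt.ne
  have : (mu - lam) * cos s ^ m * sol m lam c₀ c₁ s * sol m mu c₀ c₁ s ≠ 0 := by positivity
  exact this h0

lemma exists_isLUB_sol {m e : ℕ} {c₀ c₁ a : ℝ} (ha0 : 0 < a) (ha : a < π / 2)
    (h₀ : c₀ ∈ Icc 0 1) (h₁ : c₁ ∈ Icc 0 1) (he : ∀ lam, ultraCoeff m lam c₀ c₁ e = 1)
    (hfac : ∀ lam x, |x| < 1 → ultra m lam c₀ c₁ x = x ^ e * ultraTail m e c₀ c₁ lam x)
    (hbdd : BddAbove {lam | ∀ s ∈ Ioc 0 a, 0 < sol m lam c₀ c₁ s}) :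
    ∃ Λ, (∀ μ, (∀ lam, (∀ s ∈ Ioc 0 a, 0 < sol m lam c₀ c₁ s) → lam ≤ μ) → Λ ≤ μ) ∧
      (∀ s ∈ Ioo 0 a, 0 < sol m Λ c₀ c₁ s) ∧ sol m Λ c₀ c₁ a = 0 := by
  have habs : ∀ s ∈ Icc 0 a, |s| < π / 2 := fun s hs => by
    rw [abs_of_nonneg hs.1]; exact hs.2.trans_lt ha
  have hsin1 : sin a < 1 := (abs_lt.1 (abs_sin_lt_one (habs a ⟨ha0.le, le_rfl⟩))).2
  have hsinpos : ∀ s ∈ Ioc 0 a, 0 < sin s := fun s hs =>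
    sin_pos_of_pos_of_lt_pi hs.1 (by linarith [hs.2, pi_pos])
  have hsinle : ∀ s ∈ Icc 0 a, sin s ∈ Icc 0 (sin a) := fun s hs =>
    ⟨sin_nonneg_of_nonneg_of_le_pi hs.1 (by linarith [hs.2, pi_pos]),
      sin_le_sin_of_le_of_le_pi_div_two (by linarith [hs.1, pi_pos]) ha.le hs.2⟩
  have habs' : ∀ x ∈ Icc 0 (sin a), |x| < 1 := fun x hx => by
    rw [abs_of_nonneg hx.1]; exact hx.2.trans_lt hsin1
  have hcont : ∀ lam, ∀ x ∈ Icc 0 (sin a),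
      ContinuousAt (Function.uncurry (ultraTail m e c₀ c₁)) (lam, x) := fun lam x hx =>
    continuousAt_ultraTail m e (abs_le.2 ⟨by linarith [h₀.1], h₀.2⟩)
      (abs_le.2 ⟨by linarith [h₁.1], h₁.2⟩) lam (habs' x hx)
  have hsub : ∀ lam, (∀ x ∈ Icc 0 (sin a), 0 < ultraTail m e c₀ c₁ lam x) →
      ∀ s ∈ Ioc 0 a, 0 < sol m lam c₀ c₁ s := fun lam h s hs => by
    rw [sol, hfac lam _ (abs_sin_lt_one (habs s (Ioc_subset_Icc_self hs)))]
    exact mul_pos (pow_pos (hsinpos s hs) _) (h _ (hsinle s (Ioc_subset_Icc_self hs)))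
  have hmem : (0 : ℝ) ∈ {lam | ∀ x ∈ Icc 0 (sin a), 0 < ultraTail m e c₀ c₁ lam x} :=
    fun x hx => one_pos.trans_le
      (one_le_ultraTail m e h₀.1 h₁.1 (he 0) hx.1 (hx.2.trans_lt hsin1))
  obtain ⟨Λ, hlub, hnn, x₀, hx₀, hx₀z⟩ := exists_isLUB_touch hcont ⟨0, hmem⟩
    (hbdd.mono fun lam h => hsub lam h)
  have hΛ : 0 < Λ := (hlub.1 hmem).lt_of_ne <| by
    rintro rfl
    exact (hmem x₀ hx₀).ne' hx₀z
  have hnear : ∀ᶠ s in nhdsWithin 0 (Ioi 0), 0 < sol m Λ c₀ c₁ s := by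
    have h1 : ContinuousAt (fun s => ultraTail m e c₀ c₁ Λ (sin s)) 0 :=
      ContinuousAt.comp (g := Function.uncurry (ultraTail m e c₀ c₁))
        (f := fun s => (Λ, sin s)) (by
          rw [sin_zero]; exact hcont Λ 0 ⟨le_rfl, (hsinpos a ⟨ha0, le_rfl⟩).le⟩) (by fun_prop)
    have h2 : ∀ᶠ s in nhds (0 : ℝ), 0 < ultraTail m e c₀ c₁ Λ (sin s) :=
      h1.eventually_const_lt (by simp [ultraTail_zero_right, he])
    filter_upwards [h2.filter_mono nhdsWithin_le_nhds, Ioc_mem_nhdsGT ha0] with s hs hsa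
    rw [sol, hfac Λ _ (abs_sin_lt_one (habs s (Ioc_subset_Icc_self hsa)))]
    exact mul_pos (pow_pos (hsinpos s hsa) _) hs
  have hpos := sol_pos_of_nonneg ha hΛ (hsub 0 hmem) (fun s hs => by
    rw [sol, hfac Λ _ (abs_sin_lt_one (habs s hs))]
    exact mul_nonneg (pow_nonneg (hsinle s hs).1 _) (hnn _ (hsinle s hs))) hnear
  refine ⟨Λ, fun μ hμ => hlub.2 fun lam h => hμ lam (hsub lam h), hpos, ?_⟩
  have hx₀0 : x₀ ≠ 0 := by
    rintro rfl
    rw [ultraTail_zero_right, he] at hx₀z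
    exact one_ne_zero hx₀z
  have hx₀1 := (abs_lt.1 (habs' x₀ hx₀)).2
  have hs₀ : sin (arcsin x₀) = x₀ := sin_arcsin (by linarith [hx₀.1]) hx₀1.le
  have hs₀pos : 0 < arcsin x₀ := arcsin_pos.2 (hx₀.1.lt_of_ne' hx₀0)
  have hs₀le : arcsin x₀ ≤ a := by
    rw [← arcsin_sin (by linarith [pi_pos] : -(π / 2) ≤ a) ha.le]
    exact monotone_arcsin hx₀.2
  have hz : sol m Λ c₀ c₁ (arcsin x₀) = 0 := by
    rw [sol, hs₀, hfac Λ _ (habs' x₀ hx₀), hx₀z, mul_zero]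
  obtain h | h := hs₀le.eq_or_lt
  · rwa [h] at hz
  · exact absurd hz (hpos _ ⟨hs₀pos, h⟩).ne'

lemma integrableOn_deriv_sq_mul {c d : ℝ} (hcd : c < d) {φ w : ℝ → ℝ}
    (hφ : ContDiffOn ℝ 1 φ (Icc c d)) (hw : Continuous w) :
    MeasureTheory.IntegrableOn (fun s => deriv φ s ^ 2 * w s) (Icc c d) := by
  have h1 : ContinuousOn (fun s => derivWithin φ (Icc c d) s ^ 2 * w s) (Icc c d) :=
    ((hφ.continuousOn_derivWithin (uniqueDiffOn_Icc hcd) le_rfl).pow 2).mul hw.continuousOn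
  have h2 := h1.integrableOn_Icc (μ := MeasureTheory.volume)
  rw [integrableOn_Icc_iff_integrableOn_Ioo] at h2 ⊢
  refine h2.congr_fun (fun s hs => ?_) measurableSet_Ioo
  simp only [derivWithin_of_mem_nhds (Icc_mem_nhds hs.1 hs.2)]

/-- Picone's inequality for the weight `cos ^ m`. -/
lemma mul_integral_sq_le_integral_deriv_sq {m : ℕ} {c d lam : ℝ} {φ u u' : ℝ → ℝ} (hcd : c < d)
    (hcos : ∀ s ∈ Ioo c d, 0 ≤ cos s) (hφ : ContDiffOn ℝ 1 φ (Icc c d))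
    (hu : ∀ s ∈ Ioo c d, HasDerivAt u (u' s) s)
    (hu' : ∀ s ∈ Ioo c d,
      HasDerivAt (fun s => cos s ^ m * u' s) (-(lam * cos s ^ m * u s)) s)
    (hne : ∀ s ∈ Ioo c d, u s ≠ 0)
    (hF : ContinuousOn (fun s => φ s ^ 2 * (cos s ^ m * u' s) / u s) (Icc c d))
    (hc : φ c = 0) (hd : φ d = 0) :
    lam * ∫ s in c..d, φ s ^ 2 * cos s ^ m ≤ ∫ s in c..d, deriv φ s ^ 2 * cos s ^ m := by
  have hi1 := integrableOn_deriv_sq_mul hcd hφ (continuous_cos.pow m)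
  have hi2 : MeasureTheory.IntegrableOn (fun s => φ s ^ 2 * cos s ^ m) (Icc c d) :=
    ((hφ.continuousOn.pow 2).mul (continuous_cos.pow m).continuousOn).integrableOn_Icc
  have hφd : ∀ s ∈ Ioo c d, HasDerivAt φ (deriv φ s) s := fun s hs =>
    ((hφ.differentiableOn one_ne_zero).differentiableAt (Icc_mem_nhds hs.1 hs.2)).hasDerivAt
  have key := intervalIntegral.sub_le_integral_of_hasDeriv_right_of_le hcd.le hF
    (fun s hs => (((((hφd s hs).pow 2).mul (hu' s hs)).div (hu s hs)
      (hne s hs))).hasDerivWithinAt)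
    (hi1.sub (hi2.const_mul lam)) (fun s hs => by
      have hn := hne s hs
      have h0 : 0 ≤ cos s ^ m * (deriv φ s - φ s * u' s / u s) ^ 2 :=
        mul_nonneg (pow_nonneg (hcos s hs) m) (sq_nonneg _)
      rw [← sub_nonneg]
      refine h0.trans_eq ?_
      simp only [Pi.sub_apply, Pi.pow_apply, Pi.mul_apply]
      field_simp
      ring)
  simp only [hc, hd, Pi.sub_apply] at key
  rw [intervalIntegral.integral_sub, intervalIntegral.integral_const_mul] at key
  · norm_num at key
    exact key
  · exact (intervalIntegrable_iff_integrableOn_Icc_of_le hcd.le).2 hi1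
  · exact (intervalIntegrable_iff_integrableOn_Icc_of_le hcd.le).2 (hi2.const_mul lam)

section RayleighQuotient

variable {n : ℕ} {D : ℝ}

lemma abs_lt_of_mem_Icc (hDπ : D < π) {s : ℝ} (hs : s ∈ Icc (-(D / 2)) (D / 2)) :
    |s| < π / 2 := by
  rw [abs_lt]
  constructor <;> linarith [hs.1, hs.2]

lemma integral_sq_mul_cos_pow_pos (hD : 0 < D) (hDπ : D < π) {φ : ℝ → ℝ}
    (hφ : ContinuousOn φ (Icc (-(D / 2)) (D / 2)))
    (hne : ∃ s ∈ Icc (-(D / 2)) (D / 2), φ s ≠ 0) :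
    0 < ∫ s in (-(D / 2))..(D / 2), φ s ^ 2 * cos s ^ (n - 1) := by
  refine intervalIntegral.integral_pos (by linarith)
    ((hφ.pow 2).mul (continuous_cos.pow _).continuousOn) (fun s hs => ?_) ?_
  · have := cos_pos_of_abs_lt (abs_lt_of_mem_Icc hDπ (Ioc_subset_Icc_self hs))
    positivity
  · obtain ⟨s, hs, h⟩ := hne
    have := cos_pos_of_abs_lt (abs_lt_of_mem_Icc hDπ hs)
    exact ⟨s, hs, by positivity⟩

lemma rayleighQ_nonneg (hD : 0 < D) (hDπ : D < π) (φ : ℝ → ℝ) : 0 ≤ rayleighQ n D φ := by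
  have h : ∀ f : ℝ → ℝ, 0 ≤ ∫ s in (-(D / 2))..(D / 2), f s ^ 2 * cos s ^ (n - 1) := fun f =>
    intervalIntegral.integral_nonneg (by linarith) fun s hs => by
      have := cos_pos_of_abs_lt (abs_lt_of_mem_Icc hDπ hs)
      positivity
  exact div_nonneg (h _) (h _)

lemma bddBelow_rayleighQ_image (hD : 0 < D) (hDπ : D < π) (A : Set (ℝ → ℝ)) :
    BddBelow (rayleighQ n D '' A) :=
  ⟨0, by rintro _ ⟨φ, -, rfl⟩; exact rayleighQ_nonneg hD hDπ φ⟩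

lemma le_rayleighQ_of_sol_even_pos (hD : 0 < D) (hDπ : D < π) {lam : ℝ}
    (hpos : ∀ s ∈ Ioc 0 (D / 2), 0 < sol (n - 1) lam 1 0 s) {φ : ℝ → ℝ}
    (hφ : ContDiffOn ℝ 1 φ (Icc (-(D / 2)) (D / 2)))
    (hne : ∃ s ∈ Icc (-(D / 2)) (D / 2), φ s ≠ 0)
    (hl : φ (-(D / 2)) = 0) (hr : φ (D / 2) = 0) : lam ≤ rayleighQ n D φ := by
  have hpos' : ∀ s ∈ Icc (-(D / 2)) (D / 2), sol (n - 1) lam 1 0 s ≠ 0 := by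
    intro s hs
    rcases lt_trichotomy s 0 with h | rfl | h
    · rw [← sol_even]
      exact (hpos _ ⟨by linarith, by linarith [hs.1]⟩).ne'
    · rw [sol_zero_right]
      exact one_ne_zero
    · exact (hpos s ⟨h, hs.2⟩).ne'
  have habs : ∀ s ∈ Icc (-(D / 2)) (D / 2), |s| < π / 2 := fun s => abs_lt_of_mem_Icc hDπ
  rw [rayleighQ, le_div_iff₀ (integral_sq_mul_cos_pow_pos hD hDπ hφ.continuousOn hne)]
  refine mul_integral_sq_le_integral_deriv_sq (by linarith)
    (fun s hs => (cos_pos_of_abs_lt (habs s (Ioo_subset_Icc_self hs))).le) hφ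
    (fun s hs => hasDerivAt_sol _ _ _ _ (habs s (Ioo_subset_Icc_self hs)))
    (fun s hs => hasDerivAt_cos_pow_mul_solDeriv _ _ _ _ (habs s (Ioo_subset_Icc_self hs)))
    (fun s hs => hpos' s (Ioo_subset_Icc_self hs)) ?_ hl hr
  exact ((hφ.continuousOn.pow 2).mul ((continuous_cos.pow _).continuousOn.mul
    ((continuousOn_solDeriv _ _ _ _).mono habs))).div
    ((continuousOn_sol _ _ _ _).mono habs) hpos'

lemma le_rayleighQ_of_sol_odd_pos (hD : 0 < D) (hDπ : D < π) {lam : ℝ}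
    (hpos : ∀ s ∈ Ioc 0 (D / 2), 0 < sol (n - 1) lam 0 1 s) {φ : ℝ → ℝ}
    (hφ : ContDiffOn ℝ 1 φ (Icc (-(D / 2)) (D / 2)))
    (hne : ∃ s ∈ Icc (-(D / 2)) (D / 2), φ s ≠ 0)
    (hodd : ∀ s ∈ Icc (-(D / 2)) (D / 2), φ (-s) = -φ s)
    (hl : φ (-(D / 2)) = 0) (hr : φ (D / 2) = 0) : lam ≤ rayleighQ n D φ := by
  have hpos' : ∀ s ∈ Icc (-(D / 2)) (D / 2), s ≠ 0 → sol (n - 1) lam 0 1 s ≠ 0 := by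
    intro s hs hs0
    rcases lt_or_gt_of_ne hs0 with h | h
    · rw [← neg_ne_zero, ← sol_odd]
      exact (hpos _ ⟨by linarith, by linarith [hs.1]⟩).ne'
    · exact (hpos s ⟨h, hs.2⟩).ne'
  have habs : ∀ s ∈ Icc (-(D / 2)) (D / 2), |s| < π / 2 := fun s => abs_lt_of_mem_Icc hDπ
  have h0mem : Icc (-(D / 2)) (D / 2) ∈ nhds (0 : ℝ) := Icc_mem_nhds (by linarith) (by linarith)
  have hφ0 : φ 0 = 0 := by
    have := hodd 0 (mem_of_mem_nhds h0mem)
    rw [neg_zero] at this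
    linarith
  have hcont : ContinuousOn (fun s => φ s ^ 2 * (cos s ^ (n - 1) * solDeriv (n - 1) lam 0 1 s) /
      sol (n - 1) lam 0 1 s) (Icc (-(D / 2)) (D / 2)) := by
    intro s hs
    by_cases hs0 : s = 0
    · subst hs0
      refine ContinuousAt.continuousWithinAt (continuousAt_iff_punctured_nhds.2 ?_)
      have hφd := ((hφ.differentiableOn one_ne_zero).differentiableAt h0mem).hasDerivAt
      have hud := hasDerivAt_sol (n - 1) lam 0 1 (habs 0 hs)
      have hu'd := hasDerivAt_solDeriv (n - 1) lam 0 1 (habs 0 hs)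
      have hw : ContinuousAt (fun s => φ s * (cos s ^ (n - 1) * solDeriv (n - 1) lam 0 1 s)) 0 :=
        hφd.continuousAt.mul ((continuous_cos.pow _).continuousAt.mul hu'd.continuousAt)
      have ht := (hw.tendsto.mono_left nhdsWithin_le_nhds).mul
        (hφd.tendsto_slope.div hud.tendsto_slope (by rw [solDeriv_zero_right]; exact one_ne_zero))
      simp only [hφ0, zero_mul] at ht
      simp only [hφ0, ne_eq, OfNat.ofNat_ne_zero, not_false_eq_true, zero_pow, zero_mul, zero_div]
      refine ht.congr' ?_
      filter_upwards [self_mem_nhdsWithin, mem_nhdsWithin_of_mem_nhds h0mem] with t ht0 ht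
      have := hpos' t ht ht0
      have ht0' : t ≠ 0 := ht0
      simp only [slope_def_field, hφ0, sol_zero_right, sub_zero, Pi.div_apply]
      field_simp
    · refine ContinuousWithinAt.div ?_ (((continuousOn_sol _ _ _ _).mono habs) s hs)
        (hpos' s hs hs0)
      exact ((hφ.continuousOn.pow 2).mul ((continuous_cos.pow _).continuousOn.mul
        ((continuousOn_solDeriv _ _ _ _).mono habs))) s hs
  have hpic : ∀ c d, c < d → Icc c d ⊆ Icc (-(D / 2)) (D / 2) → 0 ∉ Ioo c d → φ c = 0 →
      φ d = 0 → lam * ∫ s in c..d, φ s ^ 2 * cos s ^ (n - 1) ≤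
        ∫ s in c..d, deriv φ s ^ 2 * cos s ^ (n - 1) := by
    intro c d hcd hsub h0 hc hd
    have hsub' : ∀ s ∈ Ioo c d, s ∈ Icc (-(D / 2)) (D / 2) := fun s hs =>
      hsub (Ioo_subset_Icc_self hs)
    exact mul_integral_sq_le_integral_deriv_sq hcd
      (fun s hs => (cos_pos_of_abs_lt (habs s (hsub' s hs))).le) (hφ.mono hsub)
      (fun s hs => hasDerivAt_sol _ _ _ _ (habs s (hsub' s hs)))
      (fun s hs => hasDerivAt_cos_pow_mul_solDeriv _ _ _ _ (habs s (hsub' s hs)))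
      (fun s hs => hpos' s (hsub' s hs) (by rintro rfl; exact h0 hs)) (hcont.mono hsub) hc hd
  have hsubl : Icc (-(D / 2)) 0 ⊆ Icc (-(D / 2)) (D / 2) := Icc_subset_Icc_right (by linarith)
  have hsubr : Icc 0 (D / 2) ⊆ Icc (-(D / 2)) (D / 2) := Icc_subset_Icc_left (by linarith)
  have hL := hpic (-(D / 2)) 0 (by linarith) hsubl (by simp) hl hφ0
  have hR := hpic 0 (D / 2) (by linarith) hsubr (by simp) hφ0 hr
  have hi1 : ∀ c d, c < d → Icc c d ⊆ Icc (-(D / 2)) (D / 2) → IntervalIntegrable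
      (fun s => deriv φ s ^ 2 * cos s ^ (n - 1)) MeasureTheory.volume c d := fun c d hcd hsub =>
    (intervalIntegrable_iff_integrableOn_Icc_of_le hcd.le).2
      (integrableOn_deriv_sq_mul hcd (hφ.mono hsub) (continuous_cos.pow (n - 1)))
  have hi2 : ∀ c d, c < d → Icc c d ⊆ Icc (-(D / 2)) (D / 2) → IntervalIntegrable
      (fun s => φ s ^ 2 * cos s ^ (n - 1)) MeasureTheory.volume c d := fun c d hcd hsub =>
    ContinuousOn.intervalIntegrable_of_Icc hcd.le
      (((hφ.continuousOn.mono hsub).pow 2).mul (continuous_cos.pow (n - 1)).continuousOn)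
  rw [rayleighQ, le_div_iff₀ (integral_sq_mul_cos_pow_pos hD hDπ hφ.continuousOn hne)]
  rw [← intervalIntegral.integral_add_adjacent_intervals
      (hi1 _ _ (by linarith) hsubl) (hi1 _ _ (by linarith) hsubr),
    ← intervalIntegral.integral_add_adjacent_intervals
      (hi2 _ _ (by linarith) hsubl) (hi2 _ _ (by linarith) hsubr)]
  linarith

lemma contDiffOn_sol (m : ℕ) (lam c₀ c₁ : ℝ) (hD : 0 < D) (hDπ : D < π) :
    ContDiffOn ℝ 1 (sol m lam c₀ c₁) (Icc (-(D / 2)) (D / 2)) := by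
  have hud : UniqueDiffOn ℝ (Icc (-(D / 2)) (D / 2)) := uniqueDiffOn_Icc (by linarith)
  have hd : ∀ s ∈ Icc (-(D / 2)) (D / 2), HasDerivAt (sol m lam c₀ c₁)
      (solDeriv m lam c₀ c₁ s) s := fun s hs => hasDerivAt_sol _ _ _ _ (abs_lt_of_mem_Icc hDπ hs)
  rw [contDiffOn_one_iff_derivWithin hud]
  refine ⟨fun s hs => (hd s hs).differentiableAt.differentiableWithinAt, ?_⟩
  exact ((continuousOn_solDeriv m lam c₀ c₁).mono fun s => abs_lt_of_mem_Icc hDπ).congr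
    fun s hs => (hd s hs).hasDerivWithinAt.derivWithin (hud s hs)

lemma rayleighQ_sol {lam c₀ c₁ : ℝ} (hD : 0 < D) (hDπ : D < π)
    (hne : ∃ s ∈ Icc (-(D / 2)) (D / 2), sol (n - 1) lam c₀ c₁ s ≠ 0)
    (hl : sol (n - 1) lam c₀ c₁ (-(D / 2)) = 0) (hr : sol (n - 1) lam c₀ c₁ (D / 2) = 0) :
    rayleighQ n D (sol (n - 1) lam c₀ c₁) = lam := by
  have hle : -(D / 2) ≤ D / 2 := by linarith
  have habs : ∀ s ∈ Icc (-(D / 2)) (D / 2), |s| < π / 2 := fun s => abs_lt_of_mem_Icc hDπ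
  have hc := (continuousOn_sol (n - 1) lam c₀ c₁).mono habs
  have hc' := (continuousOn_solDeriv (n - 1) lam c₀ c₁).mono habs
  have hw := (continuous_cos.pow (n - 1)).continuousOn (s := Icc (-(D / 2)) (D / 2))
  rw [rayleighQ, div_eq_iff
    (integral_sq_mul_cos_pow_pos hD hDπ (contDiffOn_sol _ _ _ _ hD hDπ).continuousOn hne).ne']
  have h1 : ∫ s in (-(D / 2))..(D / 2), deriv (sol (n - 1) lam c₀ c₁) s ^ 2 * cos s ^ (n - 1) =
      ∫ s in (-(D / 2))..(D / 2), solDeriv (n - 1) lam c₀ c₁ s ^ 2 * cos s ^ (n - 1) := by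
    refine intervalIntegral.integral_congr fun s hs => ?_
    rw [uIcc_of_le hle] at hs
    simp only [(hasDerivAt_sol (n - 1) lam c₀ c₁ (habs s hs)).deriv]
  have hi1 : IntervalIntegrable (fun s => solDeriv (n - 1) lam c₀ c₁ s ^ 2 * cos s ^ (n - 1))
      MeasureTheory.volume (-(D / 2)) (D / 2) :=
    ContinuousOn.intervalIntegrable_of_Icc hle ((hc'.pow 2).mul hw)
  have hi2 : IntervalIntegrable (fun s => sol (n - 1) lam c₀ c₁ s ^ 2 * cos s ^ (n - 1))
      MeasureTheory.volume (-(D / 2)) (D / 2) :=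
    ContinuousOn.intervalIntegrable_of_Icc hle ((hc.pow 2).mul hw)
  have key := intervalIntegral.integral_eq_sub_of_hasDerivAt
    (a := -(D / 2)) (b := D / 2)
    (f := fun s => sol (n - 1) lam c₀ c₁ s * (cos s ^ (n - 1) * solDeriv (n - 1) lam c₀ c₁ s))
    (f' := fun s => solDeriv (n - 1) lam c₀ c₁ s ^ 2 * cos s ^ (n - 1) -
      lam * (sol (n - 1) lam c₀ c₁ s ^ 2 * cos s ^ (n - 1))) (fun s hs => by
        rw [uIcc_of_le hle] at hs
        refine ((hasDerivAt_sol (n - 1) lam c₀ c₁ (habs s hs)).mul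
          (hasDerivAt_cos_pow_mul_solDeriv (n - 1) lam c₀ c₁ (habs s hs))).congr_deriv ?_
        ring) (hi1.sub (hi2.const_mul lam))
  rw [intervalIntegral.integral_sub hi1 (hi2.const_mul lam),
    intervalIntegral.integral_const_mul] at key
  simp only [hl, hr, zero_mul, sub_zero] at key
  rw [h1]
  linarith

theorem sol_modelLam1 (hD : 0 < D) (hDπ : D < π) :
    (∀ s ∈ Ico 0 (D / 2), 0 < sol (n - 1) (modelLam1 n D) 1 0 s) ∧
      sol (n - 1) (modelLam1 n D) 1 0 (D / 2) = 0 := by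
  set φ₀ : ℝ → ℝ := fun s => (D / 2) ^ 2 - s ^ 2 with hφ₀
  have hadm₀ : ContDiffOn ℝ 1 φ₀ (Icc (-(D / 2)) (D / 2)) ∧
      (∃ s ∈ Icc (-(D / 2)) (D / 2), φ₀ s ≠ 0) ∧ φ₀ (-(D / 2)) = 0 ∧ φ₀ (D / 2) = 0 := by
    refine ⟨by fun_prop, ⟨0, ⟨by linarith, by linarith⟩, ?_⟩, by simp [hφ₀], by simp [hφ₀]⟩
    have : φ₀ 0 = (D / 2) ^ 2 := by simp only [hφ₀]; ring
    rw [this]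
    positivity
  obtain ⟨Λ, hmin, hpos, hzero⟩ := exists_isLUB_sol (m := n - 1) (e := 0) (c₀ := 1) (c₁ := 0)
    (a := D / 2) (by linarith) (by linarith) (by simp) (by simp) (fun _ => rfl)
    (fun lam x _ => ultra_eq_ultraTail_zero _ _ _ _ _)
    ⟨rayleighQ n D φ₀, fun lam h => le_rayleighQ_of_sol_even_pos hD hDπ h hadm₀.1 hadm₀.2.1
      hadm₀.2.2.1 hadm₀.2.2.2⟩
  have hne : ∃ s ∈ Icc (-(D / 2)) (D / 2), sol (n - 1) Λ 1 0 s ≠ 0 :=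
    ⟨0, ⟨by linarith, by linarith⟩, by rw [sol_zero_right]; exact one_ne_zero⟩
  have hl : sol (n - 1) Λ 1 0 (-(D / 2)) = 0 := by rw [sol_even, hzero]
  have hΛ : modelLam1 n D = Λ := by
    refine le_antisymm ?_ (hmin _ fun lam h => ?_)
    · conv_rhs => rw [← rayleighQ_sol hD hDπ hne hl hzero]
      exact csInf_le (bddBelow_rayleighQ_image hD hDπ _)
        ⟨_, ⟨contDiffOn_sol _ _ _ _ hD hDπ, hne, hl, hzero⟩, rfl⟩
    · refine le_csInf ⟨_, φ₀, hadm₀, rfl⟩ ?_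
      rintro _ ⟨φ, ⟨hφ, hφne, hφl, hφr⟩, rfl⟩
      exact le_rayleighQ_of_sol_even_pos hD hDπ h hφ hφne hφl hφr
  rw [hΛ]
  refine ⟨fun s hs => ?_, hzero⟩
  obtain h | h := hs.1.eq_or_lt
  · rw [← h, sol_zero_right]
    exact one_pos
  · exact hpos s ⟨h, hs.2⟩

theorem sol_modelLam2 (hD : 0 < D) (hDπ : D < π) :
    (∀ s ∈ Ioo 0 (D / 2), 0 < sol (n - 1) (modelLam2 n D) 0 1 s) ∧
      sol (n - 1) (modelLam2 n D) 0 1 (D / 2) = 0 := by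
  set φ₀ : ℝ → ℝ := fun s => s * ((D / 2) ^ 2 - s ^ 2) with hφ₀
  have hadm₀ : ContDiffOn ℝ 1 φ₀ (Icc (-(D / 2)) (D / 2)) ∧
      (∃ s ∈ Icc (-(D / 2)) (D / 2), φ₀ s ≠ 0) ∧
      (∀ s ∈ Icc (-(D / 2)) (D / 2), φ₀ (-s) = -φ₀ s) ∧ φ₀ (-(D / 2)) = 0 ∧ φ₀ (D / 2) = 0 := by
    refine ⟨by fun_prop, ⟨D / 4, ⟨by linarith, by linarith⟩, ?_⟩, fun s _ => ?_,
      by simp [hφ₀], by simp [hφ₀]⟩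
    · have : φ₀ (D / 4) = 3 / 64 * D ^ 3 := by simp only [hφ₀]; ring
      rw [this]
      positivity
    · simp only [hφ₀]
      ring
  obtain ⟨Λ, hmin, hpos, hzero⟩ := exists_isLUB_sol (m := n - 1) (e := 1) (c₀ := 0) (c₁ := 1)
    (a := D / 2) (by linarith) (by linarith) (by simp) (by simp) (fun _ => rfl)
    (fun lam x hx => ultra_eq_ultraTail_one _ _ _ hx)
    ⟨rayleighQ n D φ₀, fun lam h => le_rayleighQ_of_sol_odd_pos hD hDπ h hadm₀.1 hadm₀.2.1
      hadm₀.2.2.1 hadm₀.2.2.2.1 hadm₀.2.2.2.2⟩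
  have hne : ∃ s ∈ Icc (-(D / 2)) (D / 2), sol (n - 1) Λ 0 1 s ≠ 0 :=
    ⟨D / 4, ⟨by linarith, by linarith⟩, (hpos _ ⟨by linarith, by linarith⟩).ne'⟩
  have hl : sol (n - 1) Λ 0 1 (-(D / 2)) = 0 := by rw [sol_odd, hzero, neg_zero]
  have hΛ : modelLam2 n D = Λ := by
    refine le_antisymm ?_ (hmin _ fun lam h => ?_)
    · conv_rhs => rw [← rayleighQ_sol hD hDπ hne hl hzero]
      exact csInf_le (bddBelow_rayleighQ_image hD hDπ _)
        ⟨_, ⟨contDiffOn_sol _ _ _ _ hD hDπ, hne, fun s _ => sol_odd _ _ _, hl, hzero⟩, rfl⟩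
    · refine le_csInf ⟨_, φ₀, hadm₀, rfl⟩ ?_
      rintro _ ⟨φ, ⟨hφ, hφne, hφodd, hφl, hφr⟩, rfl⟩
      exact le_rayleighQ_of_sol_odd_pos hD hDπ h hφ hφne hφodd hφl hφr
  rw [hΛ]
  exact ⟨hpos, hzero⟩

end RayleighQuotient

/-- `u` is an even Dirichlet ground state of `-d²/dx² + V` on `[-1, 1]` with eigenvalue `α`,
described on `[0, 1]`. -/
structure IsEvenState (V : ℝ → ℝ) (α : ℝ) (u u' : ℝ → ℝ) : Prop where
  hasDerivAt : ∀ x ∈ Icc (0 : ℝ) 1, HasDerivAt u (u' x) x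
  hasDerivAt' : ∀ x ∈ Icc (0 : ℝ) 1, HasDerivAt u' ((V x - α) * u x) x
  deriv_zero : u' 0 = 0
  one : u 1 = 0
  pos : ∀ x ∈ Ico (0 : ℝ) 1, 0 < u x

/-- `u` is an odd Dirichlet eigenfunction of `-d²/dx² + V` on `[-1, 1]` with eigenvalue `α`,
positive on `(0, 1)`, described on `[0, 1]`. -/
structure IsOddState (V : ℝ → ℝ) (α : ℝ) (u u' : ℝ → ℝ) : Prop where
  hasDerivAt : ∀ x ∈ Icc (0 : ℝ) 1, HasDerivAt u (u' x) x
  hasDerivAt' : ∀ x ∈ Icc (0 : ℝ) 1, HasDerivAt u' ((V x - α) * u x) x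
  zero : u 0 = 0
  deriv_zero : 0 < u' 0
  one : u 1 = 0
  pos : ∀ x ∈ Ioo (0 : ℝ) 1, 0 < u x

lemma hasDerivAt_wronskian {V₁ V₂ u u' v v' : ℝ → ℝ} {α β x : ℝ}
    (hu : HasDerivAt u (u' x) x) (hu' : HasDerivAt u' ((V₁ x - α) * u x) x)
    (hv : HasDerivAt v (v' x) x) (hv' : HasDerivAt v' ((V₂ x - β) * v x) x) :
    HasDerivAt (fun x => u x * v' x - u' x * v x)
      ((V₂ x - V₁ x - (β - α)) * (u x * v x)) x := by
  refine ((hu.mul hv').sub (hu'.mul hv)).congr_deriv ?_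
  ring

lemma IsEvenState.strictMonoOn_div {V u u' w w' : ℝ → ℝ} {α β : ℝ} (hu : IsEvenState V α u u')
    (hw : IsOddState V β w w') : StrictMonoOn (fun x => w x / u x) (Ioo 0 1) := by
  set T : ℝ → ℝ := fun x => u x * w' x - u' x * w x with hT
  have hTd : ∀ x ∈ Icc (0 : ℝ) 1, HasDerivAt T ((α - β) * (u x * w x)) x := fun x hx =>
    (hasDerivAt_wronskian (hu.hasDerivAt x hx) (hu.hasDerivAt' x hx) (hw.hasDerivAt x hx)
      (hw.hasDerivAt' x hx)).congr_deriv (by ring)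
  have hTc : ContinuousOn T (Icc 0 1) := fun x hx =>
    (hTd x hx).continuousAt.continuousWithinAt
  have hT0 : 0 < T 0 := by
    simp only [hT, hw.zero, mul_zero, sub_zero]
    exact mul_pos (hu.pos 0 ⟨le_rfl, one_pos⟩) hw.deriv_zero
  have hT1 : T 1 = 0 := by simp [hT, hu.one, hw.one]
  have huw : ∀ x ∈ Ioo (0 : ℝ) 1, 0 < u x * w x := fun x hx =>
    mul_pos (hu.pos x (Ioo_subset_Ico_self hx)) (hw.pos x hx)
  have hαβ : α < β := by
    by_contra! hle
    have hmono : MonotoneOn T (Icc 0 1) := monotoneOn_of_hasDerivWithinAt_nonneg (convex_Icc 0 1)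
      hTc (fun x hx => (hTd x (interior_subset hx)).hasDerivWithinAt) fun x hx => by
        rw [interior_Icc] at hx
        exact mul_nonneg (sub_nonneg.2 hle) (huw x hx).le
    have := hmono ⟨le_rfl, zero_le_one⟩ ⟨zero_le_one, le_rfl⟩ zero_le_one
    linarith
  have hanti : StrictAntiOn T (Icc 0 1) := strictAntiOn_of_hasDerivWithinAt_neg (convex_Icc 0 1)
    hTc (fun x hx => (hTd x (interior_subset hx)).hasDerivWithinAt) fun x hx => by
      rw [interior_Icc] at hx
      exact mul_neg_of_neg_of_pos (sub_neg.2 hαβ) (huw x hx)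
  have hd : ∀ x ∈ Ioo (0 : ℝ) 1, HasDerivAt (fun x => w x / u x)
      ((w' x * u x - w x * u' x) / u x ^ 2) x := fun x hx =>
    (hw.hasDerivAt x (Ioo_subset_Icc_self hx)).div (hu.hasDerivAt x (Ioo_subset_Icc_self hx))
      (hu.pos x (Ioo_subset_Ico_self hx)).ne'
  refine strictMonoOn_of_hasDerivWithinAt_pos (convex_Ioo 0 1)
    (fun x hx => (hd x hx).continuousAt.continuousWithinAt)
    (fun x hx => (hd x (interior_subset hx)).hasDerivWithinAt) fun x hx => ?_
  rw [interior_Ioo] at hx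
  have hTx : 0 < T x := by
    rw [← hT1]
    exact hanti (Ioo_subset_Icc_self hx) ⟨zero_le_one, le_rfl⟩ hx.2
  refine div_pos ?_ (pow_pos (hu.pos x (Ioo_subset_Ico_self hx)) 2)
  simp only [hT] at hTx
  linarith

/-- Adding an increasing function of `|x|` to the potential increases the spectral gap. -/
theorem gap_lt_gap_of_strictMonoOn_sub {V₁ V₂ u₁ u₁' u₂ u₂' v₁ v₁' v₂ v₂' : ℝ → ℝ}
    {α₁ α₂ β₁ β₂ : ℝ} (hV : StrictMonoOn (fun x => V₂ x - V₁ x) (Icc 0 1))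
    (hu₁ : IsEvenState V₁ α₁ u₁ u₁') (hu₂ : IsOddState V₁ α₂ u₂ u₂')
    (hv₁ : IsEvenState V₂ β₁ v₁ v₁') (hv₂ : IsOddState V₂ β₂ v₂ v₂') :
    α₂ - α₁ < β₂ - β₁ := by
  set F₁ : ℝ → ℝ := fun x => u₁ x * v₁' x - u₁' x * v₁ x with hF₁
  set F₂ : ℝ → ℝ := fun x => u₂ x * v₂' x - u₂' x * v₂ x with hF₂
  have hF₁d : ∀ x ∈ Icc (0 : ℝ) 1, HasDerivAt F₁
      ((V₂ x - V₁ x - (β₁ - α₁)) * (u₁ x * v₁ x)) x := fun x hx =>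
    hasDerivAt_wronskian (hu₁.hasDerivAt x hx) (hu₁.hasDerivAt' x hx) (hv₁.hasDerivAt x hx)
      (hv₁.hasDerivAt' x hx)
  have hF₂d : ∀ x ∈ Icc (0 : ℝ) 1, HasDerivAt F₂
      ((V₂ x - V₁ x - (β₂ - α₂)) * (u₂ x * v₂ x)) x := fun x hx =>
    hasDerivAt_wronskian (hu₂.hasDerivAt x hx) (hu₂.hasDerivAt' x hx) (hv₂.hasDerivAt x hx)
      (hv₂.hasDerivAt' x hx)
  have hF₁0 : F₁ 0 = 0 := by simp [hF₁, hu₁.deriv_zero, hv₁.deriv_zero]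
  have hF₁1 : F₁ 1 = 0 := by simp [hF₁, hu₁.one, hv₁.one]
  have hF₂0 : F₂ 0 = 0 := by simp [hF₂, hu₂.zero, hv₂.zero]
  have hF₂1 : F₂ 1 = 0 := by simp [hF₂, hu₂.one, hv₂.one]
  have hp₁ : ∀ x ∈ Ioo (0 : ℝ) 1, 0 < u₁ x * v₁ x := fun x hx =>
    mul_pos (hu₁.pos x (Ioo_subset_Ico_self hx)) (hv₁.pos x (Ioo_subset_Ico_self hx))
  have hp₂ : ∀ x ∈ Ioo (0 : ℝ) 1, 0 < u₂ x * v₂ x := fun x hx =>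
    mul_pos (hu₂.pos x hx) (hv₂.pos x hx)
  obtain ⟨x₀, hx₀, hx₀z⟩ := exists_hasDerivAt_eq_zero one_pos
    (fun x hx => (hF₁d x hx).continuousAt.continuousWithinAt) (hF₁0.trans hF₁1.symm)
    (fun x hx => hF₁d x (Ioo_subset_Icc_self hx))
  have hW₀ : V₂ x₀ - V₁ x₀ = β₁ - α₁ :=
    sub_eq_zero.1 ((mul_eq_zero.1 hx₀z).resolve_right (hp₁ x₀ hx₀).ne')
  by_contra! hle
  set R : ℝ → ℝ := fun x => (u₂ x / u₁ x) * (v₂ x / v₁ x) with hR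
  have hRmono : StrictMonoOn R (Ioo 0 1) := fun x hx y hy hxy =>
    mul_lt_mul'' (hu₁.strictMonoOn_div hu₂ hx hy hxy) (hv₁.strictMonoOn_div hv₂ hx hy hxy)
      (div_pos (hu₂.pos x hx) (hu₁.pos x (Ioo_subset_Ico_self hx))).le
      (div_pos (hv₂.pos x hx) (hv₁.pos x (Ioo_subset_Ico_self hx))).le
  have hReq : ∀ x ∈ Ioo (0 : ℝ) 1, u₂ x * v₂ x = R x * (u₁ x * v₁ x) := fun x hx => by
    have h1 := hu₁.pos x (Ioo_subset_Ico_self hx)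
    have h2 := hv₁.pos x (Ioo_subset_Ico_self hx)
    simp only [hR]
    field_simp
  set G : ℝ → ℝ := fun x => F₂ x - R x₀ * F₁ x with hG
  set G' : ℝ → ℝ := fun x => (V₂ x - V₁ x - (β₂ - α₂)) * (u₂ x * v₂ x) -
    R x₀ * ((V₂ x - V₁ x - (β₁ - α₁)) * (u₁ x * v₁ x)) with hG'
  have hGd : ∀ x ∈ Icc (0 : ℝ) 1, HasDerivAt G (G' x) x := fun x hx =>
    (hF₂d x hx).sub ((hF₁d x hx).const_mul _)
  have hGpos : ∀ x ∈ Ioo (0 : ℝ) 1, x ≠ x₀ → 0 < G' x := by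
    intro x hx hne
    have hprod : 0 < (V₂ x - V₁ x - (β₁ - α₁)) * (R x - R x₀) := by
      rcases lt_or_gt_of_ne hne with h | h
      · have h1 : V₂ x - V₁ x < V₂ x₀ - V₁ x₀ :=
          hV (Ioo_subset_Icc_self hx) (Ioo_subset_Icc_self hx₀) h
        exact mul_pos_of_neg_of_neg (by linarith) (sub_neg.2 (hRmono hx hx₀ h))
      · have h1 : V₂ x₀ - V₁ x₀ < V₂ x - V₁ x :=
          hV (Ioo_subset_Icc_self hx₀) (Ioo_subset_Icc_self hx) h
        exact mul_pos (by linarith) (sub_pos.2 (hRmono hx₀ hx h))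
    have h1 := mul_pos hprod (hp₁ x hx)
    have h2 : 0 ≤ ((β₁ - α₁) - (β₂ - α₂)) * (u₂ x * v₂ x) :=
      mul_nonneg (by linarith) (hp₂ x hx).le
    have h3 : G' x = (V₂ x - V₁ x - (β₁ - α₁)) * (R x - R x₀) * (u₁ x * v₁ x) +
        ((β₁ - α₁) - (β₂ - α₂)) * (u₂ x * v₂ x) := by
      simp only [hG']
      linear_combination (V₂ x - V₁ x - (β₁ - α₁)) * hReq x hx
    linarith
  have hlt : ∀ c d, 0 ≤ c → d ≤ 1 → c < d → x₀ ∉ Ioo c d → G c < G d := by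
    intro c d hc hd hcd hx
    have hsub : Icc c d ⊆ Icc 0 1 := Icc_subset_Icc hc hd
    refine strictMonoOn_of_hasDerivWithinAt_pos (convex_Icc c d)
      (fun x hx => (hGd x (hsub hx)).continuousAt.continuousWithinAt)
      (fun x hx => (hGd x (hsub (interior_subset hx))).hasDerivWithinAt) (fun y hy => ?_)
      (left_mem_Icc.2 hcd.le) (right_mem_Icc.2 hcd.le) hcd
    rw [interior_Icc] at hy
    exact hGpos y ⟨hc.trans_lt hy.1, hy.2.trans_le hd⟩ (by rintro rfl; exact hx hy)
  have hG0 : G 0 = 0 := by simp [hG, hF₁0, hF₂0]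
  have hG1 : G 1 = 0 := by simp [hG, hF₁1, hF₂1]
  have := hlt 0 x₀ le_rfl hx₀.2.le hx₀.1 (by simp)
  have := hlt x₀ 1 hx₀.1.le le_rfl hx₀.2 (by simp)
  linarith

/-- The Liouville transform of `sol`, rescaled by `a`. -/
def liouville (m : ℕ) (a lam c₀ c₁ x : ℝ) : ℝ :=
  cos (a * x) ^ ((m : ℝ) / 2) * sol m lam c₀ c₁ (a * x)

/-- The derivative of `liouville` in its last variable. -/
def liouvilleDeriv (m : ℕ) (a lam c₀ c₁ x : ℝ) : ℝ :=
  a * (cos (a * x) ^ ((m : ℝ) / 2) *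
    (solDeriv m lam c₀ c₁ (a * x) - m / 2 * tan (a * x) * sol m lam c₀ c₁ (a * x)))

/-- The potential of the Liouville normal form, up to an additive constant. -/
def liouvillePotential (m : ℕ) (a x : ℝ) : ℝ :=
  (m / 2 : ℝ) * (m / 2 - 1) * (a * tan (a * x)) ^ 2

lemma hasDerivAt_cos_rpow (k : ℝ) {s : ℝ} (hs : 0 < cos s) :
    HasDerivAt (fun s => cos s ^ k) (-(k * tan s) * cos s ^ k) s := by
  refine ((hasDerivAt_cos s).rpow_const (Or.inl hs.ne')).congr_deriv ?_
  rw [rpow_sub_one hs.ne', tan_eq_sin_div_cos]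
  ring

lemma inv_cos_sq_eq {s : ℝ} (hs : 0 < cos s) : 1 / cos s ^ 2 = 1 + tan s ^ 2 := by
  rw [tan_eq_sin_div_cos]
  field_simp
  linarith [sin_sq_add_cos_sq s]

section Liouville

variable {m : ℕ} {a lam c₀ c₁ x : ℝ}

lemma hasDerivAt_liouville (hx : |a * x| < π / 2) :
    HasDerivAt (liouville m a lam c₀ c₁) (liouvilleDeriv m a lam c₀ c₁ x) x := by
  have hlin : HasDerivAt (fun x => a * x) a x := by simpa using (hasDerivAt_id x).const_mul a
  refine (((hasDerivAt_cos_rpow (m / 2) (cos_pos_of_abs_lt hx)).mul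
    (hasDerivAt_sol m lam c₀ c₁ hx)).comp x hlin).congr_deriv ?_
  rw [liouvilleDeriv]
  ring

lemma hasDerivAt_liouvilleDeriv (hx : |a * x| < π / 2) :
    HasDerivAt (liouvilleDeriv m a lam c₀ c₁)
      ((liouvillePotential m a x - a ^ 2 * (m / 2 + lam)) * liouville m a lam c₀ c₁ x) x := by
  have hlin : HasDerivAt (fun x => a * x) a x := by simpa using (hasDerivAt_id x).const_mul a
  have hc := cos_pos_of_abs_lt hx
  have ht := (hasDerivAt_tan hc.ne').congr_deriv (inv_cos_sq_eq hc)
  refine ((((hasDerivAt_cos_rpow (m / 2) hc).mul ((hasDerivAt_solDeriv m lam c₀ c₁ hx).sub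
    ((ht.const_mul ((m : ℝ) / 2)).mul (hasDerivAt_sol m lam c₀ c₁ hx)))).comp x
    hlin).const_mul a).congr_deriv ?_
  simp only [liouville, liouvillePotential, Pi.sub_apply, Pi.mul_apply]
  ring

lemma abs_mul_lt (ha0 : 0 < a) (ha : a < π / 2) (hx : x ∈ Icc (0 : ℝ) 1) :
    |a * x| < π / 2 := by
  rw [abs_of_nonneg (mul_nonneg ha0.le hx.1)]
  nlinarith [hx.2]

lemma isEvenState_liouville (ha0 : 0 < a) (ha : a < π / 2)
    (hpos : ∀ s ∈ Ico 0 a, 0 < sol m lam 1 0 s) (hzero : sol m lam 1 0 a = 0) :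
    IsEvenState (liouvillePotential m a) (a ^ 2 * (m / 2 + lam)) (liouville m a lam 1 0)
      (liouvilleDeriv m a lam 1 0) where
  hasDerivAt x hx := hasDerivAt_liouville (abs_mul_lt ha0 ha hx)
  hasDerivAt' x hx := hasDerivAt_liouvilleDeriv (abs_mul_lt ha0 ha hx)
  deriv_zero := by simp [liouvilleDeriv, solDeriv_zero_right]
  one := by simp [liouville, hzero]
  pos x hx := mul_pos
    (rpow_pos_of_pos (cos_pos_of_abs_lt (abs_mul_lt ha0 ha (Ico_subset_Icc_self hx))) _)
    (hpos _ ⟨mul_nonneg ha0.le hx.1, mul_lt_of_lt_one_right ha0 hx.2⟩)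

lemma isOddState_liouville (ha0 : 0 < a) (ha : a < π / 2)
    (hpos : ∀ s ∈ Ioo 0 a, 0 < sol m lam 0 1 s) (hzero : sol m lam 0 1 a = 0) :
    IsOddState (liouvillePotential m a) (a ^ 2 * (m / 2 + lam)) (liouville m a lam 0 1)
      (liouvilleDeriv m a lam 0 1) where
  hasDerivAt x hx := hasDerivAt_liouville (abs_mul_lt ha0 ha hx)
  hasDerivAt' x hx := hasDerivAt_liouvilleDeriv (abs_mul_lt ha0 ha hx)
  zero := by simp [liouville, sol_zero_right]
  deriv_zero := by simpa [liouvilleDeriv, solDeriv_zero_right] using ha0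
  one := by simp [liouville, hzero]
  pos x hx := mul_pos
    (rpow_pos_of_pos (cos_pos_of_abs_lt (abs_mul_lt ha0 ha (Ioo_subset_Icc_self hx))) _)
    (hpos _ ⟨mul_pos ha0 hx.1, mul_lt_of_lt_one_right ha0 hx.2⟩)

lemma hasDerivAt_liouvillePotential (hx : |a * x| < π / 2) :
    HasDerivAt (liouvillePotential m a) ((m / 2 : ℝ) * (m / 2 - 1) *
      (2 * (a ^ 3 * (tan (a * x) * (1 + tan (a * x) ^ 2))))) x := by
  have hlin : HasDerivAt (fun x => a * x) a x := by simpa using (hasDerivAt_id x).const_mul a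
  have hc := cos_pos_of_abs_lt hx
  have ht := (hasDerivAt_tan hc.ne').congr_deriv (inv_cos_sq_eq hc)
  refine ((((ht.comp x hlin).const_mul a).pow 2).const_mul _).congr_deriv ?_
  simp only [Function.comp]
  push_cast
  ring

lemma strictMonoOn_liouvillePotential_sub (hm : 3 ≤ m) {a b : ℝ} (ha : 0 < a) (hab : a < b)
    (hb : b < π / 2) :
    StrictMonoOn (fun x => liouvillePotential m b x - liouvillePotential m a x) (Icc 0 1) := by
  have hd : ∀ x ∈ Icc (0 : ℝ) 1, HasDerivAt
      (fun x => liouvillePotential m b x - liouvillePotential m a x) _ x := fun x hx =>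
    (hasDerivAt_liouvillePotential (abs_mul_lt (ha.trans hab) hb hx)).sub
      (hasDerivAt_liouvillePotential (abs_mul_lt ha (hab.trans hb) hx))
  refine strictMonoOn_of_hasDerivWithinAt_pos (convex_Icc 0 1)
    (fun x hx => (hd x hx).continuousAt.continuousWithinAt)
    (fun x hx => (hd x (interior_subset hx)).hasDerivWithinAt) fun x hx => ?_
  rw [interior_Icc] at hx
  have hm' : (3 : ℝ) ≤ m := by exact_mod_cast hm
  have hax : 0 < a * x := mul_pos ha hx.1
  have hbx : b * x < π / 2 :=
    (abs_lt.1 (abs_mul_lt (ha.trans hab) hb (Ioo_subset_Icc_self hx))).2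
  have hlt : a * x < b * x := mul_lt_mul_of_pos_right hab hx.1
  have ht0 : 0 < tan (a * x) := tan_pos_of_pos_of_lt_pi_div_two hax (hlt.trans hbx)
  have ht : tan (a * x) < tan (b * x) := tan_lt_tan_of_nonneg_of_lt_pi_div_two hax.le hbx hlt
  have hmain : a ^ 3 * (tan (a * x) * (1 + tan (a * x) ^ 2)) <
      b ^ 3 * (tan (b * x) * (1 + tan (b * x) ^ 2)) := by gcongr
  have hc : (0 : ℝ) < m / 2 * (m / 2 - 1) := by nlinarith
  rw [← mul_sub, ← mul_sub]
  exact mul_pos hc (mul_pos two_pos (sub_pos.2 hmain))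

end Liouville

/-- For `n ≥ 4`, the normalized model gap `D²·(λ̄₂(n,D) − λ̄₁(n,D))`
is strictly increasing in `D` on `(0, π)`. -/
theorem model_gap_strictMono (n : ℕ) (hn : 4 ≤ n) (D₁ D₂ : ℝ)
    (h1 : 0 < D₁) (h12 : D₁ < D₂) (h2 : D₂ < π) :
    D₁ ^ 2 * (modelLam2 n D₁ - modelLam1 n D₁) < D₂ ^ 2 * (modelLam2 n D₂ - modelLam1 n D₂) := by
  have h2' : D₂ / 2 < π / 2 := by linarith
  have h1' : D₁ / 2 < π / 2 := by linarith
  have h02 : 0 < D₂ := h1.trans h12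
  have h1π : D₁ < π := h12.trans h2
  obtain ⟨p11, z11⟩ := sol_modelLam1 (n := n) h1 h1π
  obtain ⟨p12, z12⟩ := sol_modelLam2 (n := n) h1 h1π
  obtain ⟨p21, z21⟩ := sol_modelLam1 (n := n) h02 h2
  obtain ⟨p22, z22⟩ := sol_modelLam2 (n := n) h02 h2
  have := gap_lt_gap_of_strictMonoOn_sub
    (strictMonoOn_liouvillePotential_sub (m := n - 1) (by omega) (half_pos h1)
      (div_lt_div_of_pos_right h12 two_pos) h2')
    (isEvenState_liouville (half_pos h1) h1' p11 z11)
    (isOddState_liouville (half_pos h1) h1' p12 z12)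
    (isEvenState_liouville (half_pos h02) h2' p21 z21)
    (isOddState_liouville (half_pos h02) h2' p22 z22)
  linarith
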